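/- Let n ≥ 3 and let T be a tree on n vertices having exactly q vertices of degree 2, where 0 ≤ q ≤ n−2. Then H(T) ≤ H(BS_{n,n−1−q}), with equality if and only if T is isomorphic to BS_{n,n−1−q}. -/

import Mathlib

open Finset SimpleGraph

open Classical in
/-- The Harary index: half the sum, over ordered pairs of distinct vertices, of the
reciprocal of the shortest-path distance (so each unordered pair is counted once). -/
noncomputable def harary {V : Type*} [Fintype V] (G : SimpleGraph V) : ℝ :=
  (∑ u : V, ∑ v : V, if u = v then 0 else (1 : ℝ) / (G.dist u v)) / 2

/-- The path graph `P_n` on `n` vertices. -/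
def pathG (n : ℕ) : SimpleGraph (Fin n) :=
  SimpleGraph.fromRel (fun x y => (y : ℕ) = (x : ℕ) + 1)

/-- The star graph `S_n` on `n` vertices, with center `0`. -/
def starG (n : ℕ) : SimpleGraph (Fin n) :=
  SimpleGraph.fromRel (fun x y => (x : ℕ) = 0 ∧ (y : ℕ) ≠ 0)

/-- The spider (starlike tree) `S(L 0, …, L (k-1))`: a center `none` together with `k`
disjoint paths, the `i`-th having `L i` vertices, the center joined to vertex `0` of each leg. -/
def spider {k : ℕ} (L : Fin k → ℕ) : SimpleGraph (Option (Σ i : Fin k, Fin (L i))) :=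
  SimpleGraph.fromRel (fun x y =>
    (∃ (i : Fin k) (j : Fin (L i)), x = none ∧ y = some ⟨i, j⟩ ∧ (j : ℕ) = 0) ∨
    (∃ (i : Fin k) (j j' : Fin (L i)),
      x = some ⟨i, j⟩ ∧ y = some ⟨i, j'⟩ ∧ (j' : ℕ) = (j : ℕ) + 1))

/-- Leg lengths of the balanced starlike tree `BS n k`: the legs sum to `n - 1` and
pairwise differ by at most `1`. -/
def balancedLegs (n k : ℕ) : Fin k → ℕ :=
  fun i => (n - 1) / k + if (i : ℕ) < (n - 1) % k then 1 else 0

/-- The balanced starlike tree `BS_{n,k}` on `n` vertices with `k` legs of almost equal length. -/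
def BS (n k : ℕ) : SimpleGraph (Option (Σ i : Fin k, Fin (balancedLegs n k i))) :=
  spider (balancedLegs n k)

/-- Leg lengths of the broom `B_{n,k}`: one leg with `n - k` vertices, `k - 1` legs with one. -/
def broomLegs (n k : ℕ) : Fin k → ℕ := fun i => if (i : ℕ) = 0 then n - k else 1

/-- The broom `B_{n,k} = S(n-k, 1, …, 1)`. -/
def broom (n k : ℕ) : SimpleGraph (Option (Σ i : Fin k, Fin (broomLegs n k i))) :=
  spider (broomLegs n k)

/-- Leg lengths of the spur `A_{n,m}`: `n - m - 1` legs with two vertices, the rest with one. -/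
def spurLegs (n m : ℕ) : Fin m → ℕ := fun i => if (i : ℕ) < n - m - 1 then 2 else 1

/-- The spur `A_{n,m}`: the star `S_{m+1}` with a pendent edge attached to `n - m - 1`
of its pendent vertices. -/
def spur (n m : ℕ) : SimpleGraph (Option (Σ i : Fin m, Fin (spurLegs n m i))) :=
  spider (spurLegs n m)

/-- The caterpillar `C_{n,d,i}`: a path `v_0 v_1 … v_d` with `n - d - 1` pendent
vertices attached at `v_i`. -/
def caterpillar (n d i : ℕ) : SimpleGraph (Fin (d + 1) ⊕ Fin (n - d - 1)) :=
  SimpleGraph.fromRel (fun x y =>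
    (∃ a b : Fin (d + 1), x = Sum.inl a ∧ y = Sum.inl b ∧ (b : ℕ) = (a : ℕ) + 1) ∨
    (∃ (a : Fin (d + 1)) (p : Fin (n - d - 1)), (a : ℕ) = i ∧ x = Sum.inl a ∧ y = Sum.inr p))

/-- Degree of a vertex. -/
noncomputable def deg {V : Type*} [Fintype V] (G : SimpleGraph V) (v : V) : ℕ :=
  (G.neighborSet v).ncard

/-- Eccentricity of a vertex: the maximum distance to another vertex. -/
noncomputable def ecc {V : Type*} [Fintype V] (G : SimpleGraph V) (v : V) : ℕ :=
  Finset.univ.sup fun u => G.dist v u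

/-- Diameter of a graph: the maximum eccentricity. -/
noncomputable def graphDiam {V : Type*} [Fintype V] (G : SimpleGraph V) : ℕ :=
  Finset.univ.sup fun v => ecc G v

/-- Radius of a graph: the minimum eccentricity. -/
noncomputable def graphRadius {V : Type*} [Fintype V] (G : SimpleGraph V) : ℕ :=
  sInf (Set.range fun v => ecc G v)

/-- Matching number: the maximum cardinality of a set of pairwise non-incident edges. -/
noncomputable def matchingNumber {V : Type*} [Fintype V] (G : SimpleGraph V) : ℕ :=
  sSup {k | ∃ M : Finset (Sym2 V), M.card = k ∧ (∀ e ∈ M, e ∈ G.edgeSet) ∧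
    ∀ e ∈ M, ∀ f ∈ M, e ≠ f → ∀ v : V, ¬(v ∈ e ∧ v ∈ f)}

/-- Independence number: the maximum cardinality of a set of pairwise non-adjacent vertices. -/
noncomputable def indepNum {V : Type*} [Fintype V] (G : SimpleGraph V) : ℕ :=
  sSup {k | ∃ s : Finset V, s.card = k ∧ ∀ u ∈ s, ∀ v ∈ s, u ≠ v → ¬ G.Adj u v}

section TreeDistance

variable {V : Type*} {T : SimpleGraph V}

/-- The vertices that are strictly closer to `a` than to `b`. -/
def side (T : SimpleGraph V) (a b : V) : Set V := {x | T.dist x a < T.dist x b}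

lemma SimpleGraph.IsTree.dist_adj (hT : T.IsTree) (x : V) {a b : V} (h : T.Adj a b) :
    T.dist x a = T.dist x b + 1 ∨ T.dist x b = T.dist x a + 1 :=
  hT.dist_eq_dist_add_one_of_adj x h

lemma SimpleGraph.Connected.exists_parent (hT : T.Connected) {x a : V} (h : x ≠ a) :
    ∃ b, T.Adj a b ∧ T.dist x a = T.dist x b + 1 := by
  obtain ⟨p, hp⟩ := hT.exists_walk_length_eq_dist a x
  cases p with
  | nil => exact absurd rfl h
  | @cons _ b _ hab p =>
    refine ⟨b, hab, ?_⟩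
    have h1 := dist_le p
    have h2 := hT.dist_triangle (u := a) (v := b) (w := x)
    have h3 := dist_eq_one_iff_adj.2 hab
    simp only [Walk.length_cons] at hp
    rw [dist_comm (u := x), dist_comm (u := x)]
    omega

lemma SimpleGraph.IsTree.parent_unique (hT : T.IsTree) {x a b c : V} (hb : T.Adj a b)
    (hc : T.Adj a c) (hb' : T.dist x a = T.dist x b + 1) (hc' : T.dist x a = T.dist x c + 1) :
    b = c := by
  have key : ∀ d, T.Adj a d → T.dist x a = T.dist x d + 1 →
      ∃ p : T.Walk a x, p.IsPath ∧ p.snd = d := by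
    intro d hd hd'
    obtain ⟨p, hp⟩ := hT.connected.exists_walk_length_eq_dist d x
    refine ⟨Walk.cons hd p, Walk.isPath_of_length_eq_dist _ ?_, by simp⟩
    rw [Walk.length_cons, hp, dist_comm (u := a), dist_comm (u := d), hd']
  obtain ⟨p, hp, rfl⟩ := key b hb hb'
  obtain ⟨q, hq, rfl⟩ := key c hc hc'
  have := (hT.existsUnique_path a x).unique hp hq
  rw [this]

lemma mem_side_comm (hT : T.IsTree) {a b : V} (h : T.Adj a b) {x : V} :
    x ∉ side T a b ↔ x ∈ side T b a := by
  have := hT.dist_adj x h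
  simp only [side, Set.mem_ofPred_eq]
  omega

lemma dist_of_mem_side (hT : T.IsTree) {a b : V} (h : T.Adj a b) {x : V} (hx : x ∈ side T a b) :
    T.dist x b = T.dist x a + 1 := by
  have := hT.dist_adj x h
  simp only [side, Set.mem_ofPred_eq] at hx
  omega

lemma left_mem_side {a b : V} (h : T.Adj a b) : a ∈ side T a b := by
  simp [side, dist_eq_one_iff_adj.2 h]

lemma right_notMem_side {a b : V} : b ∉ side T a b := by
  simp [side]

/-- The only edge leaving `side T a b` is `ab`. -/
lemma eq_of_adj_of_mem_side (hT : T.IsTree) {a b x y : V} (h : T.Adj a b)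
    (hx : x ∈ side T a b) (hy : y ∉ side T a b) (hxy : T.Adj x y) : x = a ∧ y = b := by
  rw [mem_side_comm hT h] at hy
  have hxb := dist_of_mem_side hT h hx
  have hya := dist_of_mem_side hT h.symm hy
  have h1 := hT.dist_adj a hxy
  have h2 := hT.dist_adj b hxy
  rw [dist_comm (u := a), dist_comm (u := a) (v := y)] at h1
  rw [dist_comm (u := b), dist_comm (u := b) (v := y)] at h2
  by_cases hxa : x = a
  · subst hxa
    refine ⟨rfl, ?_⟩
    rw [dist_self] at *
    exact hT.connected.dist_eq_zero_iff.1 (by omega)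
  · obtain ⟨z, hz, hz'⟩ := hT.connected.exists_parent (Ne.symm hxa)
    have h3 := hT.connected.dist_triangle (u := z) (v := a) (w := b)
    have h4 := hT.dist_adj b hz
    have h5 := dist_eq_one_iff_adj.2 h
    rw [dist_comm (u := a), dist_comm (u := a) (v := z)] at hz'
    rw [dist_comm (u := b), dist_comm (u := b) (v := z)] at h4
    have : y = z := by
      refine hT.parent_unique (x := b) hxy hz ?_ ?_ <;>
        rw [dist_comm (u := b), dist_comm (u := b)] <;> omega
    subst this
    omega

/-- If every edge between `M` and its complement ends in `v`, then distances across add up. -/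
lemma dist_add_of_cut (hT : T.Connected) {M : Set V} {v : V}
    (hM : ∀ m x, m ∈ M → x ∉ M → T.Adj m x → x = v) {m x : V} (hm : m ∈ M) (hx : x ∉ M) :
    T.dist m x = T.dist m v + T.dist v x := by
  refine le_antisymm hT.dist_triangle ?_
  obtain ⟨p, hp⟩ := hT.exists_walk_length_eq_dist m x
  rw [← hp]
  clear hp
  induction p with
  | nil => exact absurd hm hx
  | @cons m y x h p ih =>
    rw [Walk.length_cons]
    have h1 := dist_eq_one_iff_adj.2 h
    by_cases hy : y ∈ M
    · have := ih hy hx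
      have := hT.dist_triangle (u := m) (v := y) (w := v)
      omega
    · obtain rfl := hM _ _ hm hy h
      have := dist_le p
      omega

lemma dist_across (hT : T.IsTree) {a b x y : V} (h : T.Adj a b) (hx : x ∈ side T a b)
    (hy : y ∈ side T b a) : T.dist x y = T.dist x a + 1 + T.dist b y := by
  have hx' := (mem_side_comm hT h.symm).2 hx
  have := dist_add_of_cut hT.connected (M := side T b a) (v := a)
    (fun m z hm hz hmz => (eq_of_adj_of_mem_side hT h.symm hm hz hmz).2) hy hx'
  rw [dist_comm, this, dist_of_mem_side hT h.symm hy, dist_comm (u := a), dist_comm (u := b)]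
  omega

end TreeDistance

section Shift

variable {V : Type*} {T : SimpleGraph V}

/-- Reattach the part `M` of the graph `T` from the vertex `v` to the vertex `u`. -/
def shift (T : SimpleGraph V) (M : Set V) (v u : V) (hu : u ∉ M) : SimpleGraph V where
  Adj x y := (T.Adj x y ∧ (x ∈ M ↔ y ∈ M)) ∨ (x ∈ M ∧ y = u ∧ T.Adj x v) ∨
    (y ∈ M ∧ x = u ∧ T.Adj y v)
  symm := ⟨by
    rintro x y (⟨h, h'⟩ | h | h)
    · exact Or.inl ⟨h.symm, h'.symm⟩
    · exact Or.inr (Or.inr h)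
    · exact Or.inr (Or.inl h)⟩
  loopless := ⟨by
    rintro x (⟨h, -⟩ | ⟨h, rfl, -⟩ | ⟨h, rfl, -⟩)
    · exact h.ne rfl
    · exact hu h
    · exact hu h⟩

lemma exists_walk_map {W : Type*} {G : SimpleGraph V} {G' : SimpleGraph W} (φ : V → W)
    (hφ : ∀ x y, G.Adj x y → φ x = φ y ∨ G'.Adj (φ x) (φ y)) {x y : V} (p : G.Walk x y) :
    ∃ q : G'.Walk (φ x) (φ y), q.length ≤ p.length := by
  induction p with
  | nil => exact ⟨Walk.nil, le_rfl⟩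
  | @cons a b c h p ih =>
    obtain ⟨q, hq⟩ := ih
    rcases hφ _ _ h with h' | h'
    · refine ⟨q.copy h'.symm rfl, ?_⟩
      simp only [Walk.length_copy, Walk.length_cons]
      omega
    · refine ⟨Walk.cons h' q, ?_⟩
      simp only [Walk.length_cons]
      omega

/-- A map sending edges to edges or to single vertices does not increase distances. -/
lemma dist_map_le {W : Type*} {G : SimpleGraph V} {G' : SimpleGraph W} (hG : G.Connected)
    (φ : V → W) (hφ : ∀ x y, G.Adj x y → φ x = φ y ∨ G'.Adj (φ x) (φ y)) (x y : V) :
    G'.Reachable (φ x) (φ y) ∧ G'.dist (φ x) (φ y) ≤ G.dist x y := by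
  obtain ⟨p, hp⟩ := hG.exists_walk_length_eq_dist x y
  obtain ⟨q, hq⟩ := exists_walk_map φ hφ p
  exact ⟨⟨q⟩, (dist_le q).trans (hq.trans hp.le)⟩

variable {M : Set V} {v u : V}

lemma shift_dist_outside (hT : T.Connected) (hM : ∀ m x, m ∈ M → x ∉ M → T.Adj m x → x = v)
    (hu : u ∉ M) {x y : V} (hx : x ∉ M) (hy : y ∉ M) :
    (shift T M v u hu).Reachable x y ∧ (shift T M v u hu).dist x y ≤ T.dist x y := by
  classical
  have := dist_map_le (G' := shift T M v u hu) hT (fun z => if z ∈ M then v else z) ?_ x y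
  · simpa only [if_neg hx, if_neg hy] using this
  intro a b hab
  by_cases ha : a ∈ M <;> by_cases hb : b ∈ M <;> simp only [ha, hb, if_true, if_false]
  · exact Or.inl trivial
  · exact Or.inl (hM a b ha hb hab).symm
  · exact Or.inl (hM b a hb ha hab.symm)
  · exact Or.inr (Or.inl ⟨hab, by simp [ha, hb]⟩)

lemma shift_dist_inside (hT : T.Connected) (hM : ∀ m x, m ∈ M → x ∉ M → T.Adj m x → x = v)
    (hu : u ∉ M) (x y : V) :
    haveI := Classical.propDecidable
    (shift T M v u hu).Reachable (if x ∈ M then x else u) (if y ∈ M then y else u) ∧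
    (shift T M v u hu).dist (if x ∈ M then x else u) (if y ∈ M then y else u) ≤ T.dist x y := by
  classical
  convert dist_map_le (G' := shift T M v u hu) hT (fun z => if z ∈ M then z else u) ?_ x y
  intro a b hab
  by_cases ha : a ∈ M <;> by_cases hb : b ∈ M <;> simp only [ha, hb, if_true, if_false]
  · exact Or.inr (Or.inl ⟨hab, by simp [ha, hb]⟩)
  · obtain rfl := hM a b ha hb hab
    exact Or.inr (Or.inr (Or.inl ⟨ha, rfl, hab⟩))
  · obtain rfl := hM b a hb ha hab.symm
    exact Or.inr (Or.inr (Or.inr ⟨hb, rfl, hab.symm⟩))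
  · exact Or.inl trivial

lemma shift_dist_inner (hT : T.Connected) (hM : ∀ m x, m ∈ M → x ∉ M → T.Adj m x → x = v)
    (hu : u ∉ M) {x y : V} (hx : x ∈ M) (hy : y ∈ M) :
    (shift T M v u hu).dist x y ≤ T.dist x y := by
  simpa only [if_pos hx, if_pos hy] using (shift_dist_inside hT hM hu x y).2

lemma shift_connected (hT : T.Connected) (hM : ∀ m x, m ∈ M → x ∉ M → T.Adj m x → x = v)
    (hv : v ∉ M) (hu : u ∉ M) : (shift T M v u hu).Connected := by
  have key : ∀ x, (shift T M v u hu).Reachable x u := by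
    intro x
    by_cases hx : x ∈ M
    · simpa only [if_pos hx, if_neg hv] using (shift_dist_inside hT hM hu x v).1
    · exact (shift_dist_outside hT hM hu hx hu).1
  exact { preconnected := fun x y => (key x).trans (key y).symm, nonempty := ⟨v⟩ }

lemma shift_dist_cross (hT : T.Connected) (hM : ∀ m x, m ∈ M → x ∉ M → T.Adj m x → x = v)
    (hv : v ∉ M) (hu : u ∉ M) {m x : V} (hm : m ∈ M) (hx : x ∉ M) :
    (shift T M v u hu).dist m x ≤ T.dist m v + T.dist u x := by
  have h1 := (shift_dist_inside hT hM hu m v).2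
  simp only [if_pos hm, if_neg hv] at h1
  have h2 := (shift_dist_outside hT hM hu hu hx).2
  have h3 := (shift_connected hT hM hv hu).dist_triangle (u := m) (v := u) (w := x)
  omega

lemma inv_dist_le_inv_dist {G G' : SimpleGraph V} (hG : G'.Connected) {x y : V}
    (h : G'.dist x y ≤ G.dist x y) : ((G.dist x y : ℝ))⁻¹ ≤ ((G'.dist x y : ℝ))⁻¹ := by
  by_cases hxy : x = y
  · simp [hxy]
  · have := hG.pos_dist_of_ne hxy
    gcongr

variable [Fintype V]

lemma harary_eq (G : SimpleGraph V) : harary G = (∑ x, ∑ y, ((G.dist x y : ℝ))⁻¹) / 2 := by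
  classical
  unfold harary
  congr 1
  refine Finset.sum_congr rfl fun x _ => Finset.sum_congr rfl fun y _ => ?_
  split_ifs with h
  · simp [h]
  · rw [one_div]

open Classical in
lemma sum_sum_split (M : Set V) (g : V → V → ℝ) (hg : ∀ x y, g x y = g y x) :
    ∑ x, ∑ y, g x y = (∑ x with x ∈ M, ∑ y with y ∈ M, g x y) +
      (∑ x with x ∉ M, ∑ y with y ∉ M, g x y) + 2 * ∑ x with x ∈ M, ∑ y with y ∉ M, g x y := by
  have h1 : ∀ x, ∑ y, g x y = (∑ y with y ∈ M, g x y) + ∑ y with y ∉ M, g x y := fun x =>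
    (Finset.sum_filter_add_sum_filter_not _ _ _).symm
  simp_rw [h1, Finset.sum_add_distrib]
  rw [← Finset.sum_filter_add_sum_filter_not univ (· ∈ M) (fun x => ∑ y with y ∈ M, g x y),
    ← Finset.sum_filter_add_sum_filter_not univ (· ∈ M) (fun x => ∑ y with y ∉ M, g x y),
    Finset.sum_comm (s := univ.filter (· ∉ M)) (t := univ.filter (· ∈ M))]
  simp_rw [hg]
  ring

open Classical in
/-- Reattaching `M` increases the Harary index, if the distances to `u` are, in a suitable sense,
smaller than those to `v`. -/
lemma harary_lt_harary_shift (hT : T.Connected)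
    (hM : ∀ m x, m ∈ M → x ∉ M → T.Adj m x → x = v) (hv : v ∉ M) (hu : u ∉ M)
    (hne : M.Nonempty)
    (h : ∀ F : ℕ → ℝ, StrictAnti F →
      ∑ x with x ∉ M, F (T.dist v x) < ∑ x with x ∉ M, F (T.dist u x)) :
    harary T < harary (shift T M v u hu) := by
  have hT' := shift_connected hT hM hv hu
  rw [harary_eq, harary_eq]
  refine div_lt_div_of_pos_right ?_ two_pos
  rw [sum_sum_split M _ (fun x y => by rw [dist_comm]),
    sum_sum_split M _ (fun x y => by rw [dist_comm])]
  refine add_lt_add_of_le_of_lt (add_le_add ?_ ?_) (mul_lt_mul_of_pos_left ?_ two_pos)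
  · refine Finset.sum_le_sum fun x hx => Finset.sum_le_sum fun y hy => ?_
    exact inv_dist_le_inv_dist hT'
      (shift_dist_inner hT hM hu (Finset.mem_filter.1 hx).2 (Finset.mem_filter.1 hy).2)
  · refine Finset.sum_le_sum fun x hx => Finset.sum_le_sum fun y hy => ?_
    exact inv_dist_le_inv_dist hT'
      (shift_dist_outside hT hM hu (Finset.mem_filter.1 hx).2 (Finset.mem_filter.1 hy).2).2
  · obtain ⟨m₀, hm₀⟩ := hne
    refine Finset.sum_lt_sum_of_nonempty ⟨m₀, by simpa using hm₀⟩ fun m hm => ?_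
    have hm := (Finset.mem_filter.1 hm).2
    have hpos : 0 < T.dist m v := hT.pos_dist_of_ne (fun h => hv (h ▸ hm))
    have hF : StrictAnti (fun j : ℕ => (((T.dist m v + j : ℕ) : ℝ))⁻¹) := by
      intro i j hij
      have : 0 < T.dist m v + i := by omega
      have h2 : T.dist m v + i < T.dist m v + j := by omega
      have h3 : ((T.dist m v + i : ℕ) : ℝ) < ((T.dist m v + j : ℕ) : ℝ) := by exact_mod_cast h2
      exact inv_strictAnti₀ (by exact_mod_cast this) h3
    refine lt_of_eq_of_lt ?_ ((h _ hF).trans_le ?_)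
    · refine Finset.sum_congr rfl fun x hx => ?_
      rw [dist_add_of_cut hT hM hm (Finset.mem_filter.1 hx).2]
    · refine Finset.sum_le_sum fun x hx => ?_
      have hx := (Finset.mem_filter.1 hx).2
      have h1 := shift_dist_cross hT hM hv hu hm hx
      have h2 : 0 < (shift T M v u hu).dist m x :=
        hT'.pos_dist_of_ne (fun h => hx (h ▸ hm))
      gcongr

end Shift

section Degrees

variable {V : Type*} [Fintype V] {T : SimpleGraph V} {M : Set V} {v u : V}

lemma sum_deg_eq (G : SimpleGraph V) : ∑ x, deg G x = 2 * Nat.card G.edgeSet := by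
  classical
  have h := G.sum_degrees_eq_twice_card_edges
  rw [Nat.card_eq_fintype_card, ← edgeFinset_card, ← h]
  refine Finset.sum_congr rfl fun x _ => ?_
  rw [deg, Set.ncard_eq_toFinset_card', Set.toFinset_card, card_neighborSet_eq_degree]

lemma SimpleGraph.IsTree.sum_deg (hT : T.IsTree) : ∑ x, deg T x + 2 = 2 * Fintype.card V := by
  have := (isTree_iff_connected_and_card.1 hT).2
  rw [sum_deg_eq, ← Nat.card_eq_fintype_card]
  omega

lemma isTree_of_sum_deg (hT : T.Connected) (h : ∑ x, deg T x + 2 = 2 * Fintype.card V) :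
    T.IsTree := by
  rw [isTree_iff_connected_and_card]
  rw [sum_deg_eq, ← Nat.card_eq_fintype_card] at h
  exact ⟨hT, by omega⟩

lemma deg_pos (hT : T.Connected) {x y : V} (h : x ≠ y) : 1 ≤ deg T x := by
  obtain ⟨b, hb, -⟩ := hT.exists_parent h.symm
  exact (Set.ncard_pos (Set.toFinite _)).2 ⟨b, hb⟩

lemma two_le_deg {x a b : V} (ha : T.Adj x a) (hb : T.Adj x b) (hab : a ≠ b) : 2 ≤ deg T x := by
  rw [← Set.ncard_pair hab]
  refine Set.ncard_le_ncard ?_ (Set.toFinite _)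
  rintro z (rfl | rfl) <;> assumption

lemma three_le_deg {x a b c : V} (ha : T.Adj x a) (hb : T.Adj x b) (hc : T.Adj x c) (hab : a ≠ b)
    (hac : a ≠ c) (hbc : b ≠ c) : 3 ≤ deg T x := by
  have h : ({a, b, c} : Set V).ncard = 3 := Set.ncard_eq_three.2 ⟨a, b, c, hab, hac, hbc, rfl⟩
  rw [← h]
  refine Set.ncard_le_ncard ?_ (Set.toFinite _)
  rintro z (rfl | rfl | rfl) <;> assumption

lemma exists_adj_ne_ne_of_three_le_deg {x : V} (h : 3 ≤ deg T x) (a b : V) :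
    ∃ c, T.Adj x c ∧ c ≠ a ∧ c ≠ b := by
  by_contra! hc
  have : (T.neighborSet x).ncard ≤ ({a, b} : Set V).ncard := by
    refine Set.ncard_le_ncard ?_ (Set.toFinite _)
    intro z hz
    by_cases hza : z = a
    · exact Or.inl hza
    · exact Or.inr (hc z hz hza)
  have h2 := Set.ncard_insert_le a {b}
  rw [Set.ncard_singleton] at h2
  unfold deg at h
  omega

lemma shift_deg_of_ne (hM : ∀ m x, m ∈ M → x ∉ M → T.Adj m x → x = v) (hv : v ∉ M) (hu : u ∉ M)
    {x : V} (hxv : x ≠ v) (hxu : x ≠ u) (huv : u ≠ v) : deg (shift T M v u hu) x = deg T x := by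
  unfold deg
  by_cases hx : x ∈ M
  · by_cases hxv' : T.Adj x v
    · have hux : u ∉ T.neighborSet x := fun h => huv (hM x u hx hu h)
      have : (shift T M v u hu).neighborSet x = insert u (T.neighborSet x \ {v}) := by
        ext y
        simp only [mem_neighborSet, shift, Set.mem_insert_iff, Set.mem_sdiff,
          Set.mem_singleton_iff]
        constructor
        · rintro (⟨h, h'⟩ | ⟨-, h, -⟩ | ⟨-, h, -⟩)
          · exact Or.inr ⟨h, fun hyv => hv (hyv ▸ h'.1 hx)⟩
          · exact Or.inl h
          · exact absurd h hxu
        · rintro (h | ⟨h, h'⟩)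
          · exact Or.inr (Or.inl ⟨hx, h, hxv'⟩)
          · refine Or.inl ⟨h, fun _ => ?_, fun _ => hx⟩
            by_contra hy
            exact h' (hM x y hx hy h)
      rw [this, Set.ncard_insert_of_notMem (fun h => hux h.1) (Set.toFinite _),
        Set.ncard_sdiff_singleton_add_one (show v ∈ T.neighborSet x from hxv') (Set.toFinite _)]
    · congr 1
      ext y
      simp only [mem_neighborSet, shift]
      constructor
      · rintro (⟨h, h'⟩ | ⟨-, -, h⟩ | ⟨-, h, -⟩)
        · exact h
        · exact absurd h hxv'
        · exact absurd h hxu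
      · intro h
        refine Or.inl ⟨h, fun _ => ?_, fun _ => hx⟩
        by_contra hy
        exact hxv' (hM x y hx hy h ▸ h)
  · congr 1
    ext y
    simp only [mem_neighborSet, shift]
    constructor
    · rintro (⟨h, h'⟩ | ⟨h, -, -⟩ | ⟨-, h, -⟩)
      · exact h
      · exact absurd h hx
      · exact absurd h hxu
    · intro h
      refine Or.inl ⟨h, fun h => absurd h hx, fun hy => ?_⟩
      exact absurd (hM y x hy hx h.symm) hxv

lemma shift_deg_source (hv : v ∉ M) (hu : u ∉ M) (huv : u ≠ v) :
    deg (shift T M v u hu) v + (T.neighborSet v ∩ M).ncard = deg T v := by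
  have : (shift T M v u hu).neighborSet v = T.neighborSet v \ M := by
    ext y
    simp only [mem_neighborSet, shift, Set.mem_sdiff]
    constructor
    · rintro (⟨h, h'⟩ | ⟨h, -, -⟩ | ⟨-, h, -⟩)
      · exact ⟨h, fun hy => hv (h'.2 hy)⟩
      · exact absurd h hv
      · exact absurd h.symm huv
    · exact fun h => Or.inl ⟨h.1, fun hv' => absurd hv' hv, fun hy => absurd hy h.2⟩
  rw [deg, this, add_comm, Set.ncard_inter_add_ncard_sdiff_eq_ncard _ _ (Set.toFinite _), deg]

lemma shift_deg_target (hM : ∀ m x, m ∈ M → x ∉ M → T.Adj m x → x = v) (hu : u ∉ M)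
    (huv : u ≠ v) :
    deg (shift T M v u hu) u = deg T u + (T.neighborSet v ∩ M).ncard := by
  have : (shift T M v u hu).neighborSet u = T.neighborSet u ∪ (T.neighborSet v ∩ M) := by
    ext y
    simp only [mem_neighborSet, shift, Set.mem_union, Set.mem_inter_iff]
    constructor
    · rintro (⟨h, -⟩ | ⟨h, -, -⟩ | ⟨hy, -, h⟩)
      · exact Or.inl h
      · exact absurd h hu
      · exact Or.inr ⟨h.symm, hy⟩
    · rintro (h | ⟨h, hy⟩)
      · refine Or.inl ⟨h, fun h => absurd h hu, fun hy => ?_⟩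
        exact absurd (hM y u hy hu h.symm) huv
      · exact Or.inr (Or.inr ⟨hy, trivial, h.symm⟩)
  rw [deg, this, Set.ncard_union_eq _ (Set.toFinite _) (Set.toFinite _), deg]
  rw [Set.disjoint_left]
  intro y hy hy'
  exact huv (hM y u hy'.2 hu (show T.Adj u y from hy).symm)

lemma shift_isTree (hT : T.IsTree) (hM : ∀ m x, m ∈ M → x ∉ M → T.Adj m x → x = v) (hv : v ∉ M)
    (hu : u ∉ M) (huv : u ≠ v) : (shift T M v u hu).IsTree := by
  classical
  refine isTree_of_sum_deg (shift_connected hT.connected hM hv hu) ?_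
  rw [← hT.sum_deg]
  congr 1
  have hs : ∀ G : SimpleGraph V, ∑ x, deg G x =
      deg G v + (deg G u + ∑ x ∈ (univ.erase v).erase u, deg G x) := by
    intro G
    rw [Finset.add_sum_erase _ _ (by simp [huv]), Finset.add_sum_erase _ _ (by simp)]
  rw [hs, hs]
  have h1 := shift_deg_source (T := T) hv hu huv
  have h2 := shift_deg_target hM hu huv
  have h3 : ∑ x ∈ (univ.erase v).erase u, deg (shift T M v u hu) x =
      ∑ x ∈ (univ.erase v).erase u, deg T x := by
    refine Finset.sum_congr rfl fun x hx => ?_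
    simp only [Finset.mem_erase, Finset.mem_univ, and_true] at hx
    exact shift_deg_of_ne hM hv hu hx.2 hx.1 huv
  omega

end Degrees

section Legs

variable {V : Type*} {T : SimpleGraph V} {v w : V}

lemma exists_parent_mem_side (hT : T.IsTree) (h : T.Adj v w) {x : V} (hx : x ∈ side T w v)
    (hxw : x ≠ w) : ∃ y ∈ side T w v, T.Adj x y ∧ T.dist v x = T.dist v y + 1 := by
  have hxv : v ≠ x := fun e => right_notMem_side (e ▸ hx)
  obtain ⟨y, hy, hy'⟩ := hT.connected.exists_parent hxv
  refine ⟨y, ?_, hy, hy'⟩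
  by_contra hys
  exact hxw (eq_of_adj_of_mem_side hT h.symm hx hys hy).1

lemma dist_pos_of_mem_side (hT : T.IsTree) {x : V} (hx : x ∈ side T w v) :
    1 ≤ T.dist v x :=
  hT.connected.pos_dist_of_ne fun e => right_notMem_side (e ▸ hx)

lemma exists_mem_side_dist_eq (hT : T.IsTree) (h : T.Adj v w) {x : V} (hx : x ∈ side T w v) {j : ℕ}
    (hj : 1 ≤ j) (hjx : j ≤ T.dist v x) : ∃ y ∈ side T w v, T.dist v y = j := by
  induction hd : T.dist v x using Nat.strong_induction_on generalizing x with
  | _ d ih =>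
    subst hd
    rcases hjx.eq_or_lt with rfl | hlt
    · exact ⟨x, hx, rfl⟩
    have hxw : x ≠ w := by
      rintro rfl
      rw [dist_eq_one_iff_adj.2 h] at hlt
      omega
    obtain ⟨y, hy, -, hy'⟩ := exists_parent_mem_side hT h hx hxw
    exact ih _ (by omega) hy (by omega) rfl

variable [Fintype V]

lemma eq_of_dist_eq_of_mem_leg (hT : T.IsTree) (h : T.Adj v w)
    (hdeg : ∀ x ∈ side T w v, deg T x ≤ 2) {x y : V} (hx : x ∈ side T w v) (hy : y ∈ side T w v)
    (hxy : T.dist v x = T.dist v y) : x = y := by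
  induction hd : T.dist v x generalizing x y with
  | zero => exact absurd (dist_pos_of_mem_side hT hx) (by omega)
  | succ d ih =>
    have hw : ∀ z ∈ side T w v, T.dist v z = 1 → z = w := by
      intro z hz h1
      have := dist_of_mem_side hT h.symm hz
      rw [dist_comm, h1] at this
      exact hT.connected.dist_eq_zero_iff.1 (by omega)
    have hvw := dist_eq_one_iff_adj.2 h
    by_cases hd0 : d = 0
    · rw [hw x hx (by omega), hw y hy (by omega)]
    have hxw : x ≠ w := by rintro rfl; omega
    have hyw : y ≠ w := by rintro rfl; omega
    obtain ⟨x', hx', hxx', hdx⟩ := exists_parent_mem_side hT h hx hxw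
    obtain ⟨y', hy', hyy', hdy⟩ := exists_parent_mem_side hT h hy hyw
    obtain rfl := ih hx' hy' (by omega) (by omega)
    have hxv : v ≠ x' := fun e => right_notMem_side (e ▸ hx')
    obtain ⟨z, hz, hdz⟩ := hT.connected.exists_parent hxv
    by_contra hne
    have h3 := three_le_deg hxx'.symm hyy'.symm hz hne (by rintro rfl; omega)
      (by rintro rfl; omega)
    have := hdeg x' hx'
    omega

lemma eq_Icc_of_downward_closed {S : Finset ℕ} (h1 : ∀ x ∈ S, 1 ≤ x)
    (h2 : ∀ x ∈ S, ∀ y, 1 ≤ y → y ≤ x → y ∈ S) : S = Finset.Icc 1 #S := by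
  rcases S.eq_empty_or_nonempty with rfl | hne
  · simp
  have : S = Finset.Icc 1 (S.max' hne) := by
    ext y
    rw [Finset.mem_Icc]
    exact ⟨fun hy => ⟨h1 y hy, S.le_max' y hy⟩, fun hy => h2 _ (S.max'_mem hne) y hy.1 hy.2⟩
  have hc : #S = S.max' hne := by
    conv_lhs => rw [this]
    simp
  rw [hc]
  exact this

open Classical in
lemma image_dist_leg (hT : T.IsTree) (h : T.Adj v w) (hdeg : ∀ x ∈ side T w v, deg T x ≤ 2) :
    (univ.filter (· ∈ side T w v)).image (T.dist v) = Finset.Icc 1 (side T w v).ncard := by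
  have hc : #((univ.filter (· ∈ side T w v)).image (T.dist v)) = (side T w v).ncard := by
    rw [Finset.card_image_of_injOn, Set.ncard_eq_toFinset_card']
    · congr 1
      ext; simp
    · intro x hx y hy hxy
      simp only [Finset.coe_filter, Finset.mem_univ, true_and] at hx hy
      exact eq_of_dist_eq_of_mem_leg hT h hdeg hx hy hxy
  rw [← hc]
  refine eq_Icc_of_downward_closed ?_ ?_
  · intro j hj
    obtain ⟨x, hx, rfl⟩ := Finset.mem_image.1 hj
    exact dist_pos_of_mem_side hT (Finset.mem_filter.1 hx).2
  · intro j hj i hi hij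
    obtain ⟨x, hx, rfl⟩ := Finset.mem_image.1 hj
    obtain ⟨y, hy, rfl⟩ := exists_mem_side_dist_eq hT h (Finset.mem_filter.1 hx).2 hi hij
    exact Finset.mem_image.2 ⟨y, by simpa using hy, rfl⟩

lemma exists_mem_leg_dist_eq_iff (hT : T.IsTree) (h : T.Adj v w)
    (hdeg : ∀ x ∈ side T w v, deg T x ≤ 2) {j : ℕ} :
    (∃ x ∈ side T w v, T.dist v x = j) ↔ 1 ≤ j ∧ j ≤ (side T w v).ncard := by
  classical
  rw [← Finset.mem_Icc, ← image_dist_leg hT h hdeg]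
  simp

open Classical in
lemma sum_leg (hT : T.IsTree) (h : T.Adj v w) (hdeg : ∀ x ∈ side T w v, deg T x ≤ 2)
    (F : ℕ → ℝ) : ∑ x with x ∈ side T w v, F (T.dist v x) =
      ∑ j ∈ range (side T w v).ncard, F (j + 1) := by
  rw [Finset.range_eq_Ico, Finset.sum_Ico_add' F 0 _ 1, zero_add]
  have : Finset.Ico 1 ((side T w v).ncard + 1) = Finset.Icc 1 (side T w v).ncard := by
    ext; simp
  rw [this, ← image_dist_leg hT h hdeg, Finset.sum_image]
  intro x hx y hy hxy
  simp only [Finset.coe_filter, Finset.mem_univ, true_and] at hx hy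
  exact eq_of_dist_eq_of_mem_leg hT h hdeg hx hy hxy

end Legs

section Improvement

variable {V : Type*} [Fintype V] {T : SimpleGraph V} {v u w : V}

open Classical in
/-- Comparison of the distances to two adjacent vertices `v` and `u`, when the part of the graph
behind `v` is a path with `r` vertices and the part at `u` is larger than a path with `r + 1`
vertices. -/
lemma sum_dist_lt_sum_dist (hT : T.IsTree) (hvu : T.Adj v u) {M : Set V} {R : Finset V} {r : ℕ}
    (hR : ∀ F : ℕ → ℝ, ∑ x ∈ R, F (T.dist v x) = ∑ j ∈ range r, F (j + 1))
    (hRs : ∀ x ∈ R, x ∈ side T v u ∧ x ≠ v)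
    (hM : ∀ x, x ∉ M ↔ x = v ∨ x ∈ R ∨ x ∈ side T u v)
    {x₁ : V} (hx₁ : x₁ ∈ side T u v) (hr : r + 1 ≤ T.dist v x₁)
    (hcard : r + 1 < (side T u v).ncard) {F : ℕ → ℝ} (hF : StrictAnti F) :
    ∑ x with x ∉ M, F (T.dist v x) < ∑ x with x ∉ M, F (T.dist u x) := by
  set U : Finset V := univ.filter (· ∈ side T u v) with hU
  have hUs : ∀ x, x ∈ U ↔ x ∈ side T u v := by simp [hU]
  have hC : univ.filter (· ∉ M) = insert v (R ∪ U) := by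
    ext x
    simp only [Finset.mem_filter, Finset.mem_univ, true_and, Finset.mem_insert, Finset.mem_union,
      hUs, hM]
  have hvn : v ∉ R ∪ U := by
    rw [Finset.mem_union, hUs]
    rintro (h | h)
    · exact (hRs v h).2 rfl
    · exact right_notMem_side h
  have hdisj : Disjoint R U := by
    rw [Finset.disjoint_left]
    intro x hx hx'
    exact (mem_side_comm hT hvu.symm).2 (hRs x hx).1 ((hUs x).1 hx')
  rw [hC, Finset.sum_insert hvn, Finset.sum_insert hvn, Finset.sum_union hdisj,
    Finset.sum_union hdisj]
  have hRu : ∑ x ∈ R, F (T.dist u x) = ∑ j ∈ range r, F (j + 1 + 1) := by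
    rw [← hR (fun j => F (j + 1))]
    refine Finset.sum_congr rfl fun x hx => ?_
    rw [dist_comm, dist_of_mem_side hT hvu (hRs x hx).1, dist_comm]
  have hUv : ∑ x ∈ U, F (T.dist v x) = ∑ x ∈ U, F (T.dist u x + 1) := by
    refine Finset.sum_congr rfl fun x hx => ?_
    rw [dist_comm, dist_of_mem_side hT hvu.symm ((hUs x).1 hx), dist_comm]
  rw [hRu, hR, hUv, dist_self, dist_comm, dist_eq_one_iff_adj.2 hvu]
  have tel : ∑ j ∈ range r, F (j + 1 + 1) - ∑ j ∈ range r, F (j + 1) = F (r + 1) - F 1 := by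
    rw [← Finset.sum_sub_distrib, Finset.sum_range_sub (fun j => F (j + 1)) r]
  have hex : ∀ j, ∃ y, j ∈ range (r + 1) → y ∈ U ∧ T.dist u y = j := by
    intro j
    by_cases hj : j ∈ range (r + 1)
    · rw [Finset.mem_range] at hj
      obtain ⟨y, hy, hyj⟩ := exists_mem_side_dist_eq hT hvu hx₁ (j := j + 1) (by omega) (by omega)
      have := dist_of_mem_side hT hvu.symm hy
      rw [dist_comm, hyj, dist_comm] at this
      exact ⟨y, fun _ => ⟨(hUs y).2 hy, by omega⟩⟩
    · exact ⟨v, fun h => absurd h hj⟩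
  choose e he using hex
  have hinj : Set.InjOn e (range (r + 1)) := by
    intro i hi j hj hij
    rw [← (he i hi).2, ← (he j hj).2, hij]
  have hsub : (range (r + 1)).image e ⊂ U := by
    refine Finset.ssubset_iff_subset_ne.2 ⟨fun y hy => ?_, fun h => ?_⟩
    · obtain ⟨j, hj, rfl⟩ := Finset.mem_image.1 hy
      exact (he j hj).1
    · have h2 := congrArg Finset.card h
      rw [Finset.card_image_of_injOn hinj, Finset.card_range] at h2
      have h3 : #U = (side T u v).ncard := by
        rw [Set.ncard_eq_toFinset_card']
        congr 1
        ext; simp [hU]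
      omega
  have hpos : ∀ j, 0 < F j - F (j + 1) := fun j => sub_pos.2 (hF (Nat.lt_succ_self j))
  obtain ⟨z, hz, hz'⟩ := Finset.exists_of_ssubset hsub
  have hlt := Finset.sum_lt_sum_of_subset (f := fun x => F (T.dist u x) - F (T.dist u x + 1))
    hsub.1 hz hz' (hpos _) (fun j _ _ => (hpos _).le)
  have himg : ∑ j ∈ range (r + 1), (F (T.dist u (e j)) - F (T.dist u (e j) + 1)) =
      F 0 - F (r + 1) := by
    rw [← Finset.sum_range_sub']
    exact Finset.sum_congr rfl fun j hj => by rw [(he j hj).2]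
  rw [Finset.sum_image hinj, himg, Finset.sum_sub_distrib] at hlt
  linarith

/-- Moving everything at `v` except for one leg to the neighbour `u`. -/
lemma exists_better_of_leg (hT : T.IsTree) (hvu : T.Adj v u) (hvw : T.Adj v w) (huw : u ≠ w)
    (hv : 3 ≤ deg T v) (hleg : ∀ x ∈ side T w v, deg T x ≤ 2)
    {x₁ : V} (hx₁ : x₁ ∈ side T u v) (hr : (side T w v).ncard + 1 ≤ T.dist v x₁)
    (hcard : (side T w v).ncard + 1 < (side T u v).ncard) (hu : 2 ≤ deg T u) :
    ∃ T' : SimpleGraph V, T'.IsTree ∧ harary T < harary T' ∧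
      {x | deg T' x = 1} = {x | deg T x = 1} ∧ ∃ c, 3 ≤ deg T' c := by
  classical
  set M : Set V := {x | x ≠ v ∧ x ∉ side T w v ∧ x ∉ side T u v} with hMdef
  have hMmem : ∀ x, x ∉ M ↔ x = v ∨ x ∈ univ.filter (· ∈ side T w v) ∨ x ∈ side T u v := by
    intro x
    simp only [hMdef, Set.mem_ofPred_eq, Finset.mem_filter, Finset.mem_univ, true_and]
    tauto
  have hvM : v ∉ M := (hMmem v).2 (Or.inl rfl)
  have huM : u ∉ M := (hMmem u).2 (Or.inr (Or.inr (left_mem_side hvu.symm)))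
  have hM : ∀ m x, m ∈ M → x ∉ M → T.Adj m x → x = v := by
    intro m x hm hx hmx
    obtain ⟨h1, h2, h3⟩ := hm
    rcases (hMmem x).1 hx with h | h | h
    · exact h
    · exact absurd (eq_of_adj_of_mem_side hT hvw.symm (by simpa using h) h2 hmx.symm).2 h1
    · exact absurd (eq_of_adj_of_mem_side hT hvu.symm h h3 hmx.symm).2 h1
  have hsd : ∀ a b, T.Adj v a → T.Adj v b → a ≠ b → a ∉ side T b v := by
    intro a b ha hb hab h
    have := dist_of_mem_side hT hb.symm h
    rw [dist_eq_one_iff_adj.2 ha.symm] at this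
    exact hab (hT.connected.dist_eq_zero_iff.1 (by omega))
  have hN : T.neighborSet v ∩ M = T.neighborSet v \ {u, w} := by
    ext x
    simp only [Set.mem_inter_iff, mem_neighborSet, Set.mem_sdiff, Set.mem_insert_iff,
      Set.mem_singleton_iff, not_or]
    refine and_congr_right fun hx => ⟨fun ⟨_, h2, h3⟩ => ⟨?_, ?_⟩, fun ⟨h1, h2⟩ => ⟨hx.ne', ?_, ?_⟩⟩
    · rintro rfl; exact h3 (left_mem_side hvu.symm)
    · rintro rfl; exact h2 (left_mem_side hvw.symm)
    · exact hsd x w hx hvw h2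
    · exact hsd x u hx hvu h1
  have hNc : (T.neighborSet v ∩ M).ncard + 2 = deg T v := by
    rw [hN, ← Set.ncard_pair huw, Set.ncard_sdiff_add_ncard_of_subset _ (Set.toFinite _), deg]
    rintro z (rfl | rfl) <;> assumption
  have hne : (T.neighborSet v ∩ M).Nonempty := by
    rw [← Set.ncard_pos (Set.toFinite _)]
    omega
  have h1 := shift_deg_source (T := T) hvM huM hvu.ne'
  have h2 := shift_deg_target hM huM hvu.ne'
  refine ⟨shift T M v u huM, shift_isTree hT hM hvM huM hvu.ne', ?_, ?_, u, by omega⟩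
  · refine harary_lt_harary_shift hT.connected hM hvM huM (hne.mono Set.inter_subset_right) ?_
    intro F hF
    refine sum_dist_lt_sum_dist hT hvu (sum_leg hT hvw hleg) ?_ hMmem hx₁ hr hcard hF
    intro x hx
    have hx : x ∈ side T w v := by simpa using hx
    refine ⟨?_, fun e => right_notMem_side (e ▸ hx)⟩
    rw [← mem_side_comm hT hvu.symm]
    intro hxu
    exact huw (hT.parent_unique hvu hvw (dist_of_mem_side hT hvu.symm hxu)
      (dist_of_mem_side hT hvw.symm hx))
  · ext x
    simp only [Set.mem_ofPred_eq]
    by_cases hxv : x = v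
    · subst hxv; omega
    by_cases hxu : x = u
    · subst hxu; omega
    rw [shift_deg_of_ne hM hvM huM hxv hxu hvu.ne']

/-- Splitting a leg: `v` becomes a leaf and the rest of its leg is attached to `u`. -/
lemma exists_better_of_split (hT : T.IsTree) (hvu : T.Adj v u) (hv : deg T v = 2)
    (hu : 3 ≤ deg T u) :
    ∃ T' : SimpleGraph V, T'.IsTree ∧ harary T < harary T' ∧
      {x | deg T' x = 1} = insert v {x | deg T x = 1} ∧ ∃ c, 3 ≤ deg T' c := by
  classical
  set M : Set V := {x | x ≠ v ∧ x ∉ side T u v} with hMdef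
  have hMmem : ∀ x, x ∉ M ↔ x = v ∨ x ∈ (∅ : Finset V) ∨ x ∈ side T u v := by
    intro x
    simp only [hMdef, Set.mem_ofPred_eq, Finset.notMem_empty, false_or]
    tauto
  have hvM : v ∉ M := (hMmem v).2 (Or.inl rfl)
  have huM : u ∉ M := (hMmem u).2 (Or.inr (Or.inr (left_mem_side hvu.symm)))
  have hM : ∀ m x, m ∈ M → x ∉ M → T.Adj m x → x = v := by
    intro m x hm hx hmx
    obtain ⟨h1, h3⟩ := hm
    rcases (hMmem x).1 hx with h | h | h
    · exact h
    · simp at h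
    · exact absurd (eq_of_adj_of_mem_side hT hvu.symm h h3 hmx.symm).2 h1
  have hN : T.neighborSet v ∩ M = T.neighborSet v \ {u} := by
    ext x
    simp only [Set.mem_inter_iff, mem_neighborSet, Set.mem_sdiff, Set.mem_singleton_iff]
    refine and_congr_right fun hx => ⟨fun ⟨_, h3⟩ => ?_, fun h1 => ⟨hx.ne', ?_⟩⟩
    · rintro rfl; exact h3 (left_mem_side hvu.symm)
    · intro h
      have := dist_of_mem_side hT hvu.symm h
      rw [dist_eq_one_iff_adj.2 hx.symm] at this
      exact h1 (hT.connected.dist_eq_zero_iff.1 (by omega))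
  have hNc : (T.neighborSet v ∩ M).ncard + 1 = deg T v := by
    rw [hN, Set.ncard_sdiff_singleton_add_one (show u ∈ T.neighborSet v from hvu)
      (Set.toFinite _), deg]
  have hne : (T.neighborSet v ∩ M).Nonempty := by
    rw [← Set.ncard_pos (Set.toFinite _)]
    omega
  have h1 := shift_deg_source (T := T) hvM huM hvu.ne'
  have h2 := shift_deg_target hM huM hvu.ne'
  refine ⟨shift T M v u huM, shift_isTree hT hM hvM huM hvu.ne', ?_, ?_, u, by omega⟩
  · refine harary_lt_harary_shift hT.connected hM hvM huM (hne.mono Set.inter_subset_right) ?_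
    intro F hF
    refine sum_dist_lt_sum_dist hT hvu (r := 0) (by simp) (by simp) hMmem
      (left_mem_side hvu.symm) (by rw [dist_eq_one_iff_adj.2 hvu]) ?_ hF
    obtain ⟨z, hz, hzv, -⟩ := exists_adj_ne_ne_of_three_le_deg hu v v
    rw [zero_add, Set.one_lt_ncard (Set.toFinite _)]
    refine ⟨u, left_mem_side hvu.symm, z, ?_, hz.ne⟩
    by_contra hzs
    exact hzv (eq_of_adj_of_mem_side hT hvu.symm (left_mem_side hvu.symm) hzs hz).2
  · ext x
    simp only [Set.mem_ofPred_eq, Set.mem_insert_iff]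
    by_cases hxv : x = v
    · subst hxv
      exact ⟨fun _ => Or.inl rfl, fun _ => by omega⟩
    by_cases hxu : x = u
    · subst hxu
      simp only [hxv, false_or]
      omega
    rw [shift_deg_of_ne hM hvM huM hxv hxu hvu.ne']
    simp [hxv]

end Improvement

section SeveralBranchVertices

variable {V : Type*} {T : SimpleGraph V}

lemma dist_of_mem_side_child (hT : T.IsTree) {x v w y : V} (h : T.Adj v w)
    (hw : T.dist x w = T.dist x v + 1) (hy : y ∈ side T w v) :
    T.dist x y = T.dist x v + 1 + T.dist w y := by
  have hx : x ∈ side T v w := by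
    rw [side, Set.mem_ofPred_eq]
    omega
  exact dist_across hT h hx hy

lemma side_child_subset (hT : T.IsTree) {v u b w : V} (hvu : T.Adj v u) (hb : b ∈ side T u v)
    (hbw : T.Adj b w) (hw : T.dist v w = T.dist v b + 1) : side T w b ⊆ side T u v := by
  intro y hy
  by_contra hyu
  rw [mem_side_comm hT hvu.symm] at hyu
  have h1 := dist_across hT hvu hyu hb
  have h2 := dist_of_mem_side_child hT hbw hw hy
  have h3 := dist_of_mem_side hT hbw.symm hy
  have h4 := dist_of_mem_side hT hvu.symm hb
  rw [dist_comm (u := v) (v := y)] at h2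
  rw [dist_comm (u := y) (v := w)] at h3
  rw [dist_comm (u := b) (v := v)] at h4
  omega

variable [Fintype V]

lemma exists_child (hT : T.IsTree) {v : V} (hv : 3 ≤ deg T v) (x a : V) :
    ∃ w, T.Adj v w ∧ w ≠ a ∧ T.dist x w = T.dist x v + 1 := by
  by_cases hxv : x = v
  · subst hxv
    obtain ⟨w, hw, hwa, -⟩ := exists_adj_ne_ne_of_three_le_deg hv a a
    exact ⟨w, hw, hwa, by rw [dist_self, dist_eq_one_iff_adj.2 hw]⟩
  · obtain ⟨p, hp, hpd⟩ := hT.connected.exists_parent hxv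
    obtain ⟨w, hw, hwa, hwp⟩ := exists_adj_ne_ne_of_three_le_deg hv a p
    exact ⟨w, hw, hwa, (hT.dist_adj x hw).resolve_left fun h => hwp (hT.parent_unique hw hp h hpd)⟩

lemma deg_le_two_of_mem_side_child (hT : T.IsTree) {x v w : V} (h : T.Adj v w)
    (hw : T.dist x w = T.dist x v + 1)
    (hmax : ∀ y ∈ side T w v, 3 ≤ deg T y → T.dist x y ≤ T.dist x v) :
    ∀ y ∈ side T w v, deg T y ≤ 2 := by
  intro y hy
  by_contra hd
  have := hmax y hy (by omega)
  have := dist_of_mem_side_child hT h hw hy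
  omega

/-- A tree with at least two branch vertices does not maximise the Harary index. -/
lemma exists_better_of_two_branch (hT : T.IsTree) {a b : V} (hab : a ≠ b) (ha : 3 ≤ deg T a)
    (hb : 3 ≤ deg T b) :
    ∃ T' : SimpleGraph V, T'.IsTree ∧ harary T < harary T' ∧
      {x | deg T' x = 1} = {x | deg T x = 1} ∧ ∃ c, 3 ≤ deg T' c := by
  classical
  set P : Set (V × V) :=
    {p | 3 ≤ deg T p.1 ∧ T.Adj p.1 p.2 ∧ ∀ x ∈ side T p.2 p.1, deg T x ≤ 2} with hP
  have hPne : P.Nonempty := by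
    obtain ⟨v, hv, hvmax⟩ := Set.exists_max_image {x | 3 ≤ deg T x} (T.dist a) (Set.toFinite _)
      ⟨a, ha⟩
    obtain ⟨w, hw, -, hwd⟩ := exists_child hT hv a a
    exact ⟨(v, w), hv, hw, deg_le_two_of_mem_side_child hT hw hwd fun y _ hy => hvmax y hy⟩
  obtain ⟨⟨v, w⟩, ⟨hv, hvw, hleg⟩, hmin⟩ :=
    Set.exists_min_image P (fun p => (side T p.2 p.1).ncard) (Set.toFinite _) hPne
  simp only at hv hvw hleg hmin
  obtain ⟨b, hb, hbv⟩ : ∃ b, 3 ≤ deg T b ∧ b ≠ v := by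
    by_cases h : a = v
    · exact ⟨b, hb, fun e => hab (h.trans e.symm)⟩
    · exact ⟨a, ha, h⟩
  obtain ⟨u, hvu, hu⟩ := hT.connected.exists_parent hbv
  have hbu : b ∈ side T u v := by
    rw [side, Set.mem_ofPred_eq]
    omega
  obtain ⟨c, ⟨hcu, hc⟩, hcmax⟩ := Set.exists_max_image {x | x ∈ side T u v ∧ 3 ≤ deg T x} (T.dist v)
    (Set.toFinite _) ⟨b, hbu, hb⟩
  obtain ⟨w₁, hw₁, -, hd₁⟩ := exists_child hT hc v v
  obtain ⟨w₂, hw₂, hne, hd₂⟩ := exists_child hT hc v w₁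
  have hs₁ := side_child_subset hT hvu hcu hw₁ hd₁
  have hs₂ := side_child_subset hT hvu hcu hw₂ hd₂
  have hl₁ := deg_le_two_of_mem_side_child hT hw₁ hd₁ fun y hy h => hcmax y ⟨hs₁ hy, h⟩
  have hl₂ := deg_le_two_of_mem_side_child hT hw₂ hd₂ fun y hy h => hcmax y ⟨hs₂ hy, h⟩
  have hm₁ := hmin (c, w₁) ⟨hc, hw₁, hl₁⟩
  have hm₂ := hmin (c, w₂) ⟨hc, hw₂, hl₂⟩
  simp only at hm₁ hm₂
  have hpos : 1 ≤ (side T w v).ncard :=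
    (Set.ncard_pos (Set.toFinite _)).2 ⟨w, left_mem_side hvw.symm⟩
  have hdisj : Disjoint (side T w₁ c) (side T w₂ c) := by
    rw [Set.disjoint_left]
    intro y h₁ h₂
    exact hne (hT.parent_unique hw₂ hw₁ (dist_of_mem_side hT hw₂.symm h₂)
      (dist_of_mem_side hT hw₁.symm h₁))
  have hcn : c ∉ side T w₁ c ∪ side T w₂ c := by
    rintro (h | h) <;> exact right_notMem_side h
  have hcard : (side T w v).ncard + 1 < (side T u v).ncard := by
    have h := Set.ncard_le_ncard (Set.insert_subset hcu (Set.union_subset hs₁ hs₂))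
      (Set.toFinite _)
    rw [Set.ncard_insert_of_notMem hcn (Set.toFinite _),
      Set.ncard_union_eq hdisj (Set.toFinite _) (Set.toFinite _)] at h
    omega
  obtain ⟨x, hx, hxd⟩ := (exists_mem_leg_dist_eq_iff hT hw₁ hl₁ (j := (side T w₁ c).ncard)).2
    ⟨by omega, le_rfl⟩
  refine exists_better_of_leg hT hvu hvw ?_ hv hleg (hs₁ hx) ?_ hcard ?_
  · rintro rfl
    have := hleg b hbu
    omega
  · have h1 := dist_of_mem_side_child hT hw₁ hd₁ hx
    have h2 := dist_of_mem_side hT hw₁.symm hx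
    have h3 := dist_pos_of_mem_side hT hcu
    rw [dist_comm (u := x) (v := c), dist_comm (u := x) (v := w₁)] at h2
    omega
  · by_cases hub : b = u
    · subst hub; omega
    · obtain ⟨z, hz, hzd⟩ := hT.connected.exists_parent hub
      exact two_le_deg hvu.symm hz fun e => by subst e; omega

end SeveralBranchVertices

section Spiders

variable {V : Type*} [Fintype V] {T : SimpleGraph V} {c : V}

lemma nonempty_iso_spider (hT : T.IsTree) (hdeg : ∀ x, x ≠ c → deg T x ≤ 2) {k : ℕ}
    (e : Fin k ≃ T.neighborSet c) {L : Fin k → ℕ} (hL : ∀ i, (side T (e i) c).ncard = L i) :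
    Nonempty (T ≃g spider L) := by
  have hadj : ∀ i, T.Adj c (e i) := fun i => (e i).2
  have hleg : ∀ i, ∀ x ∈ side T (e i : V) c, deg T x ≤ 2 := fun i x hx =>
    hdeg x fun h => right_notMem_side (h ▸ hx)
  have hex : ∀ i (j : Fin (L i)), ∃ x ∈ side T (e i : V) c, T.dist c x = j + 1 := fun i j =>
    (exists_mem_leg_dist_eq_iff hT (hadj i) (hleg i)).2 ⟨by omega, by rw [hL]; exact j.2⟩
  choose g hgs hgd using hex
  have hindex : ∀ {i i' x}, x ∈ side T (e i : V) c → x ∈ side T (e i' : V) c → i = i' := by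
    intro i i' x hx hx'
    exact e.injective (Subtype.ext (hT.parent_unique (hadj i) (hadj i')
      (dist_of_mem_side hT (hadj i).symm hx) (dist_of_mem_side hT (hadj i').symm hx')))
  have hgc : ∀ i j, g i j ≠ c := fun i j h => right_notMem_side (h ▸ hgs i j)
  have hstep : ∀ i (j j' : Fin (L i)), (j' : ℕ) = j + 1 → T.Adj (g i j) (g i j') := by
    intro i j j' hj
    obtain ⟨y, hy, hya, hyd⟩ := exists_parent_mem_side hT (hadj i) (hgs i j') (by
      intro h
      have := hgd i j'
      rw [h, dist_eq_one_iff_adj.2 (hadj i)] at this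
      omega)
    rw [hgd] at hyd
    have : y = g i j := eq_of_dist_eq_of_mem_leg hT (hadj i) (hleg i) hy (hgs i j)
      (by rw [hgd]; omega)
    exact this ▸ hya.symm
  have hback : ∀ i i' (j : Fin (L i)) (j' : Fin (L i')), T.Adj (g i j) (g i' j') →
      i = i' ∧ ((j : ℕ) = j' + 1 ∨ (j' : ℕ) = j + 1) := by
    intro i i' j j' h
    have hmem : g i' j' ∈ side T (e i : V) c := by
      by_contra hn
      exact hgc i' j' (eq_of_adj_of_mem_side hT (hadj i).symm (hgs i j) hn h).2
    refine ⟨hindex hmem (hgs i' j'), ?_⟩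
    have := hT.dist_adj c h
    rw [hgd, hgd] at this
    omega
  have hcenter : ∀ i j, T.Adj c (g i j) ↔ (j : ℕ) = 0 := by
    intro i j
    rw [← dist_eq_one_iff_adj, hgd]
    omega
  let φ : Option (Σ i : Fin k, Fin (L i)) → V := fun p => p.elim c fun s => g s.1 s.2
  have hinj : Function.Injective φ := by
    rintro (_ | ⟨i, j⟩) (_ | ⟨i', j'⟩) h
    · rfl
    · exact absurd h.symm (hgc i' j')
    · exact absurd h (hgc i j)
    · have h : g i j = g i' j' := h
      obtain rfl : i = i' := hindex (hgs i j) (h ▸ hgs i' j')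
      have h1 := hgd i j
      rw [h, hgd] at h1
      obtain rfl : j = j' := Fin.ext (by omega)
      rfl
  have hsurj : Function.Surjective φ := by
    intro x
    by_cases hx : x = c
    · exact ⟨none, hx.symm⟩
    obtain ⟨b, hb, hbd⟩ := hT.connected.exists_parent hx
    obtain ⟨i, hi⟩ := e.surjective ⟨b, hb⟩
    have hxs : x ∈ side T (e i : V) c := by
      rw [hi, side, Set.mem_ofPred_eq]
      simp only
      omega
    have hd := (exists_mem_leg_dist_eq_iff hT (hadj i) (hleg i)).1 ⟨x, hxs, rfl⟩
    rw [hL] at hd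
    refine ⟨some ⟨i, ⟨T.dist c x - 1, by omega⟩⟩, ?_⟩
    refine eq_of_dist_eq_of_mem_leg hT (hadj i) (hleg i) (hgs i _) hxs ((hgd i _).trans ?_)
    simp only
    omega
  refine ⟨RelIso.symm ⟨Equiv.ofBijective φ ⟨hinj, hsurj⟩, ?_⟩⟩
  rintro (_ | ⟨i, j⟩) (_ | ⟨i', j'⟩)
  · simp
  · change T.Adj c (g i' j') ↔ _
    rw [hcenter]
    refine ⟨fun h => ⟨by simp, Or.inl (Or.inl ⟨i', j', rfl, rfl, h⟩)⟩, ?_⟩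
    rintro ⟨-, (⟨a, b, -, h', hb⟩ | ⟨_, _, _, h, -⟩) | (⟨_, _, h, -⟩ | ⟨_, _, _, -, h, -⟩)⟩
    · rw [Option.some_inj] at h'
      cases h'
      exact hb
    all_goals simp at h
  · change T.Adj (g i j) c ↔ _
    rw [T.adj_comm, hcenter]
    refine ⟨fun h => ⟨by simp, Or.inr (Or.inl ⟨i, j, rfl, rfl, h⟩)⟩, ?_⟩
    rintro ⟨-, (⟨_, _, h, -⟩ | ⟨_, _, _, -, h, -⟩) | (⟨a, b, -, h', hb⟩ | ⟨_, _, _, h, -⟩)⟩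
    rotate_left 2
    · rw [Option.some_inj] at h'
      cases h'
      exact hb
    all_goals simp at h
  · change T.Adj (g i j) (g i' j') ↔ _
    constructor
    · intro h
      refine ⟨fun he => h.ne (congrArg φ he), ?_⟩
      obtain ⟨rfl, hj | hj⟩ := hback i i' j j' h
      · exact Or.inr (Or.inr ⟨i, j', j, rfl, rfl, hj⟩)
      · exact Or.inl (Or.inr ⟨i, j, j', rfl, rfl, hj⟩)
    · rintro ⟨-, (⟨_, _, h, -⟩ | ⟨a, b, b', h, h', hb⟩) | (⟨_, _, h, -⟩ | ⟨a, b, b', h, h', hb⟩)⟩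
      · simp at h
      · rw [Option.some_inj] at h h'
        cases h
        cases h'
        exact hstep _ _ _ hb
      · simp at h
      · rw [Option.some_inj] at h h'
        cases h
        cases h'
        exact (hstep _ _ _ hb).symm

lemma card_eq_sum_leg (hT : T.IsTree) (hdeg : ∀ x, x ≠ c → deg T x ≤ 2) {k : ℕ}
    (e : Fin k ≃ T.neighborSet c) :
    Fintype.card V = ∑ i, (side T (e i : V) c).ncard + 1 := by
  obtain ⟨f⟩ := nonempty_iso_spider hT hdeg e fun _ => rfl
  simp [Fintype.card_congr f.toEquiv]

lemma nonempty_equiv_neighborSet {k : ℕ} (hk : deg T c = k) :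
    Nonempty (Fin k ≃ T.neighborSet c) := by
  classical
  refine ⟨(Finite.equivFinOfCardEq ?_).symm⟩
  rw [← hk, deg, Nat.card_coe_set_eq]

lemma exists_equiv_balanced {α : Type*} {k N : ℕ} (hk : 0 < k) (e₀ : Fin k ≃ α) (f : α → ℕ)
    (hsum : ∑ i, f (e₀ i) = N) (hbal : ∀ a b, f a ≤ f b + 1) :
    ∃ e : Fin k ≃ α, ∀ i, f (e i) = N / k + if (i : ℕ) < N % k then 1 else 0 := by
  classical
  have : Nonempty (Fin k) := ⟨⟨0, hk⟩⟩
  obtain ⟨i₀, hi₀⟩ := Finite.exists_min fun i => f (e₀ i)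
  set m := f (e₀ i₀) with hm
  set s := #{i | f (e₀ i) = m + 1} with hs
  have hval : ∀ i, f (e₀ i) = m + if f (e₀ i) = m + 1 then 1 else 0 := by
    intro i
    have h1 := hi₀ i
    have h2 := hbal (e₀ i) (e₀ i₀)
    split_ifs <;> omega
  have hN : N = s + k * m := by
    rw [← hsum, Finset.sum_congr rfl fun i _ => hval i, Finset.sum_add_distrib, ← Finset.card_filter]
    simp [hs, add_comm]
  have hsk : s < k := by
    have h : s < #(univ : Finset (Fin k)) := by
      refine Finset.card_lt_card (Finset.filter_ssubset.2 ⟨i₀, Finset.mem_univ _, ?_⟩)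
      omega
    simpa using h
  have hdiv : N / k = m := by
    rw [hN, Nat.add_mul_div_left _ _ hk, Nat.div_eq_of_lt hsk, zero_add]
  have hmod : N % k = s := by
    rw [hN, Nat.add_mul_mod_self_left, Nat.mod_eq_of_lt hsk]
  have hc : Fintype.card {i : Fin k // (i : ℕ) < s} =
      Fintype.card {i : Fin k // f (e₀ i) = m + 1} := by
    rw [Fintype.card_subtype, Fintype.card_subtype, ← hs, Fin.card_filter_val_lt]
    omega
  let σ := (Fintype.equivOfCardEq hc).extendSubtype
  refine ⟨σ.trans e₀, fun i => ?_⟩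
  rw [hdiv, hmod, Equiv.trans_apply, hval]
  congr 1
  by_cases hi : (i : ℕ) < s
  · rw [if_pos hi, if_pos ((Fintype.equivOfCardEq hc).extendSubtype_mem i hi)]
  · rw [if_neg hi, if_neg ((Fintype.equivOfCardEq hc).extendSubtype_not_mem i hi)]

/-- A tree without branch vertices other than `c` whose legs at `c` are balanced is a balanced
starlike tree. -/
lemma nonempty_iso_BS (hT : T.IsTree) (hdeg : ∀ x, x ≠ c → deg T x ≤ 2) {k : ℕ}
    (hc : deg T c = k) (hk : 0 < k)
    (hbal : ∀ w w', T.Adj c w → T.Adj c w' → (side T w c).ncard ≤ (side T w' c).ncard + 1) :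
    Nonempty (T ≃g BS (Fintype.card V) k) := by
  obtain ⟨e₀⟩ := nonempty_equiv_neighborSet hc
  have hsum := card_eq_sum_leg hT hdeg e₀
  obtain ⟨e, he⟩ := exists_equiv_balanced hk e₀
    (fun w : T.neighborSet c => (side T (w : V) c).ncard) (N := Fintype.card V - 1) (by omega)
    fun a b => hbal a b a.2 b.2
  exact nonempty_iso_spider hT hdeg e he

lemma harary_eq_of_iso {W : Type*} [Fintype W] {G : SimpleGraph V} {G' : SimpleGraph W}
    (hG : G.Connected) (f : G ≃g G') : harary G = harary G' := by
  have hG' : G'.Connected := f.connected_iff.1 hG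
  have hd : ∀ x y, G'.dist (f x) (f y) = G.dist x y := by
    intro x y
    apply le_antisymm
    · exact hG.exists_walk_length_eq_dist x y |>.elim fun p hp =>
        hp ▸ (p.length_map f.toHom) ▸ dist_le (p.map f.toHom)
    · obtain ⟨p, hp⟩ := hG'.exists_walk_length_eq_dist (f x) (f y)
      have := dist_le (p.map f.symm.toHom)
      rw [Walk.length_map, hp] at this
      simpa using this
  rw [harary_eq, harary_eq, ← f.toEquiv.sum_comp]
  congr 1
  refine Finset.sum_congr rfl fun x _ => ?_
  rw [← f.toEquiv.sum_comp]
  exact Finset.sum_congr rfl fun y _ => by rw [← hd x y]; rfl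

end Spiders

section Maximizers

variable {V : Type*} [Fintype V] {T : SimpleGraph V}

lemma two_le_deg_of_two_le_leg (hT : T.IsTree) {c w : V} (h : T.Adj c w)
    (hleg : ∀ x ∈ side T w c, deg T x ≤ 2) (hw : 2 ≤ (side T w c).ncard) : 2 ≤ deg T w := by
  obtain ⟨x, hx, hxd⟩ := (exists_mem_leg_dist_eq_iff hT h hleg).2 ⟨one_le_two, hw⟩
  have hw1 := dist_eq_one_iff_adj.2 h
  obtain ⟨y, hy, hxy, hyd⟩ := exists_parent_mem_side hT h hx (by rintro rfl; omega)
  obtain rfl : y = w :=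
    eq_of_dist_eq_of_mem_leg hT h hleg hy (left_mem_side h.symm) (by omega)
  exact two_le_deg h.symm hxy.symm (by rintro rfl; simp at hxd)

lemma deg_eq_ncard_leaves (hT : T.IsTree) {c : V} (hc : 3 ≤ deg T c)
    (hdeg : ∀ x, x ≠ c → deg T x ≤ 2) : deg T c = {x | deg T x = 1}.ncard := by
  classical
  have hsum := hT.sum_deg
  have hval : ∀ x, deg T x + (if deg T x = 1 then 1 else 0) =
      2 + if x = c then deg T c - 2 else 0 := by
    intro x
    by_cases hx : x = c
    · subst hx
      rw [if_neg (by omega), if_pos rfl]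
      omega
    · have h1 := hdeg x hx
      have h2 := deg_pos hT.connected hx
      rw [if_neg hx]
      split_ifs <;> omega
  have h := Finset.sum_congr (rfl : (univ : Finset V) = univ) fun x _ => hval x
  rw [Finset.sum_add_distrib, Finset.sum_add_distrib, ← Finset.card_filter,
    Finset.sum_ite_eq' univ c] at h
  simp only [Finset.sum_const, Finset.card_univ, smul_eq_mul, Finset.mem_univ, if_true] at h
  rw [Set.ncard_eq_toFinset_card', Set.toFinset_ofPred]
  omega

/-- A tree with a branch vertex and at most `k` leaves either is the balanced starlike tree with
`k` legs or is improved by such a tree. -/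
lemma nonempty_iso_BS_or_exists_better (hT : T.IsTree) {c : V} (hc : 3 ≤ deg T c) {k : ℕ}
    (hleaves : {x | deg T x = 1}.ncard ≤ k) (hk : k + 1 ≤ Fintype.card V) :
    Nonempty (T ≃g BS (Fintype.card V) k) ∨ ∃ T' : SimpleGraph V, T'.IsTree ∧
      harary T < harary T' ∧ {x | deg T' x = 1}.ncard ≤ k ∧ ∃ c, 3 ≤ deg T' c := by
  by_cases hbranch : ∃ b, b ≠ c ∧ 3 ≤ deg T b
  · obtain ⟨b, hbc, hb⟩ := hbranch
    obtain ⟨T', h1, h2, h3, h4⟩ := exists_better_of_two_branch hT hbc hb hc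
    exact Or.inr ⟨T', h1, h2, h3 ▸ hleaves, h4⟩
  have hdeg : ∀ x, x ≠ c → deg T x ≤ 2 := by
    intro x hx
    by_contra h
    exact hbranch ⟨x, hx, by omega⟩
  have hleg : ∀ w, ∀ x ∈ side T w c, deg T x ≤ 2 := fun w x hx =>
    hdeg x fun h => right_notMem_side (h ▸ hx)
  by_cases hbal : ∀ w w', T.Adj c w → T.Adj c w' → (side T w c).ncard ≤ (side T w' c).ncard + 1
  · rcases hleaves.lt_or_eq with hlt | heq
    · obtain ⟨w, hw, hw2⟩ : ∃ w, T.Adj c w ∧ 2 ≤ (side T w c).ncard := by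
        by_contra! hall
        obtain ⟨e⟩ := nonempty_equiv_neighborSet (deg_eq_ncard_leaves hT hc hdeg)
        have h := card_eq_sum_leg hT hdeg e
        have h' := Finset.sum_le_card_nsmul univ (fun i => (side T (e i : V) c).ncard) 1
          fun i _ => Nat.le_of_lt_succ (hall _ (e i).2)
        simp only [Finset.card_univ, Fintype.card_fin, smul_eq_mul, mul_one] at h'
        omega
      have hwd : deg T w = 2 :=
        le_antisymm (hdeg w hw.ne') (two_le_deg_of_two_le_leg hT hw (hleg w) hw2)
      obtain ⟨T', h1, h2, h3, h4⟩ := exists_better_of_split hT hw.symm hwd hc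
      refine Or.inr ⟨T', h1, h2, ?_, h4⟩
      rw [h3]
      exact (Set.ncard_insert_le _ _).trans hlt
    · have hck := (deg_eq_ncard_leaves hT hc hdeg).trans heq
      exact Or.inl (nonempty_iso_BS hT hdeg hck (by omega) hbal)
  · push Not at hbal
    obtain ⟨u, w, hu, hw, hlt⟩ := hbal
    obtain ⟨x, hx, hxd⟩ := (exists_mem_leg_dist_eq_iff hT hu (hleg u) (j := (side T u c).ncard)).2
      ⟨by omega, le_rfl⟩
    obtain ⟨T', h1, h2, h3, h4⟩ := exists_better_of_leg hT hu hw (by rintro rfl; omega) hc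
      (hleg w) hx (by omega) hlt (two_le_deg_of_two_le_leg hT hu (hleg u) (by omega))
    exact Or.inr ⟨T', h1, h2, h3 ▸ hleaves, h4⟩

lemma ncard_leaves_add_ncard_deg_two_lt {c : V} (hc : 3 ≤ deg T c) :
    {x | deg T x = 1}.ncard + {x | deg T x = 2}.ncard < Fintype.card V := by
  rw [← Set.ncard_union_eq _ (Set.toFinite _) (Set.toFinite _), ← Nat.card_eq_fintype_card]
  · refine Set.ncard_lt_card fun h => ?_
    have : c ∈ {x | deg T x = 1} ∪ {x | deg T x = 2} := h ▸ Set.mem_univ c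
    simp only [Set.mem_union, Set.mem_ofPred_eq] at this
    omega
  · rw [Set.disjoint_left]
    intro x h1 h2
    simp only [Set.mem_ofPred_eq] at h1 h2
    omega

lemma ncard_deg_two_of_deg_le_two (hT : T.IsTree) (hcard : 2 ≤ Fintype.card V)
    (hdeg : ∀ x, deg T x ≤ 2) :
    {x | deg T x = 2}.ncard + 2 = Fintype.card V ∧ ∃ c, deg T c = 1 := by
  classical
  have : Nontrivial V := Fintype.one_lt_card_iff_nontrivial.1 hcard
  have hval : ∀ x, deg T x = 1 + if deg T x = 2 then 1 else 0 := by
    intro x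
    obtain ⟨y, hy⟩ := exists_ne x
    have h1 := hdeg x
    have h2 := deg_pos hT.connected hy.symm
    split_ifs <;> omega
  have hsum := hT.sum_deg
  rw [Finset.sum_congr rfl fun x _ => hval x, Finset.sum_add_distrib, ← Finset.card_filter] at hsum
  simp only [Finset.sum_const, Finset.card_univ, smul_eq_mul, mul_one] at hsum
  have hq : {x | deg T x = 2}.ncard = #{x | deg T x = 2} := by
    rw [Set.ncard_eq_toFinset_card', Set.toFinset_ofPred]
  refine ⟨by omega, ?_⟩
  by_contra! hall
  have : #{x | deg T x = 2} = Fintype.card V := by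
    rw [← Finset.card_univ, Finset.filter_true_of_mem]
    intro x _
    have := hval x
    have := hall x
    split_ifs at * <;> omega
  omega

end Maximizers

theorem harary_degree_two_vertices_max {V : Type*} [Fintype V] (T : SimpleGraph V)
    (hT : T.IsTree) (n q : ℕ) (hn : 3 ≤ n) (hq : q ≤ n - 2)
    (hcard : Fintype.card V = n) (hdeg2 : {v : V | deg T v = 2}.ncard = q) :
    harary T ≤ harary (BS n (n - 1 - q)) ∧
    (harary T = harary (BS n (n - 1 - q)) ↔ Nonempty (T ≃g BS n (n - 1 - q))) := by
  have heq : ∀ {G : SimpleGraph V}, G.IsTree → Nonempty (G ≃g BS n (n - 1 - q)) →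
      harary G = harary (BS n (n - 1 - q)) := fun hG ⟨f⟩ => harary_eq_of_iso hG.connected f
  by_cases hbranch : ∃ c, 3 ≤ deg T c
  · obtain ⟨c, hc⟩ := hbranch
    have hlt := ncard_leaves_add_ncard_deg_two_lt hc
    set S : Set (SimpleGraph V) :=
      {G | G.IsTree ∧ {x | deg G x = 1}.ncard ≤ n - 1 - q ∧ ∃ c, 3 ≤ deg G c} with hS
    have hTS : T ∈ S := ⟨hT, by omega, c, hc⟩
    obtain ⟨G, hGS, hmax⟩ := Set.exists_max_image S harary (Set.toFinite _) ⟨T, hTS⟩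
    have hiso : ∀ H ∈ S, harary G ≤ harary H → Nonempty (H ≃g BS n (n - 1 - q)) := by
      rintro H ⟨hH, hleaves, c, hc⟩ hle
      have h := nonempty_iso_BS_or_exists_better hH hc hleaves (by omega)
      rw [hcard] at h
      refine h.resolve_right ?_
      rintro ⟨H', h1, h2, h3⟩
      exact absurd (hmax H' ⟨h1, h3⟩) (not_le.2 (hle.trans_lt h2))
    have hG := heq hGS.1 (hiso G hGS le_rfl)
    rw [← hG]
    exact ⟨hmax T hTS, fun h => hiso T hTS h.ge, fun h => (heq hT h).trans hG.symm⟩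
  · have hdeg : ∀ x, deg T x ≤ 2 := by
      intro x
      by_contra h
      exact hbranch ⟨x, by omega⟩
    obtain ⟨hq2, c, hc⟩ := ncard_deg_two_of_deg_le_two hT (by omega) hdeg
    have hiso : Nonempty (T ≃g BS n (n - 1 - q)) := by
      rw [← hcard]
      refine nonempty_iso_BS (c := c) hT (fun x _ => hdeg x) (by omega) (by omega)
        fun w w' hw hw' => ?_
      rw [(Set.ncard_le_one (Set.toFinite (T.neighborSet c))).1 hc.le w hw w' hw']
      omega
    exact ⟨(heq hT hiso).le, fun _ => hiso, heq hT⟩
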